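/- (Theorem A(b)) Let u be a weak stationary solution density and let U be a Lyapunov function in 𝒰 with respect to ℒ with Lyapunov constant γ > 0, essential lower bound ρ_m and essential upper bound ρ_M. Let H be an upper sandwich function for U with H(t) > 0 for all t ∈ [ρ_m, ρ_M), and assume condition (R): for Lebesgue-a.e. ρ ∈ [ρ_m, ρ_M), ∇U(x) ≠ 0 for every x ∈ U^{-1}(ρ). Then for every ρ ∈ [ρ_m, ρ_M), μ(𝒰 \ Ω_ρ) ≤ exp(−γ ∫_{ρ_m}^{ρ} dt / H(t)). -/

import Mathlib

open MeasureTheory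

noncomputable section

/-- Euclidean space ℝⁿ. -/
abbrev Eucl (n : ℕ) : Type := EuclideanSpace ℝ (Fin n)

/-- First-order partial derivative `∂ᵢ f`. -/
def pd {n : ℕ} (f : Eucl n → ℝ) (i : Fin n) (x : Eucl n) : ℝ :=
  fderiv ℝ f x (EuclideanSpace.single i 1)

/-- Second-order partial derivative `∂²ᵢⱼ f`. -/
def pd2 {n : ℕ} (f : Eucl n → ℝ) (i j : Fin n) (x : Eucl n) : ℝ :=
  fderiv ℝ (fun y => fderiv ℝ f y (EuclideanSpace.single j 1)) x (EuclideanSpace.single i 1)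

/-- The adjoint Fokker–Planck operator `ℒf = aⁱʲ ∂²ᵢⱼ f + Vⁱ ∂ᵢ f`. -/
def Lop {n : ℕ} (a : Eucl n → Matrix (Fin n) (Fin n) ℝ)
    (V : Eucl n → Fin n → ℝ) (f : Eucl n → ℝ) (x : Eucl n) : ℝ :=
  (∑ i, ∑ j, a x i j * pd2 f i j x) + ∑ i, V x i * pd f i x

/-- The quadratic form `⟨a(x) ∇f(x), ∇f(x)⟩ = ∑ᵢⱼ aⁱʲ ∂ᵢf ∂ⱼf`. -/
def aQuad {n : ℕ} (a : Eucl n → Matrix (Fin n) (Fin n) ℝ)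
    (f : Eucl n → ℝ) (x : Eucl n) : ℝ :=
  ∑ i, ∑ j, a x i j * pd f i x * pd f j x

open scoped Convolution

/-- Partial derivatives of a convolution fall on the differentiable factor. -/
theorem pd_convolution {n : ℕ} {k f : Eucl n → ℝ} (hk : LocallyIntegrable k)
    (hf : ContDiff ℝ 1 f) (hc : HasCompactSupport f) (i : Fin n) :
    pd (k ⋆[ContinuousLinearMap.lsmul ℝ ℝ, volume] f) i =
      (k ⋆[ContinuousLinearMap.lsmul ℝ ℝ, volume] (pd f i)) := by
  funext x
  have h := hc.hasFDerivAt_convolution_right (ContinuousLinearMap.lsmul ℝ ℝ) hk hf x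
  rw [pd, h.fderiv, convolution_precompR_apply (ContinuousLinearMap.lsmul ℝ ℝ) hk
    (hc.fderiv (𝕜 := ℝ)) (hf.continuous_fderiv one_ne_zero)]
  rfl

theorem contDiff_pd {n : ℕ} {m m' : WithTop ℕ∞} {f : Eucl n → ℝ} (hf : ContDiff ℝ m f)
    (h : m' + 1 ≤ m) (i : Fin n) : ContDiff ℝ m' (pd f i) :=
  (hf.fderiv_right h).clm_apply contDiff_const

theorem hasCompactSupport_pd {n : ℕ} {f : Eucl n → ℝ} (hf : HasCompactSupport f) (i : Fin n) :
    HasCompactSupport (pd f i) :=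
  (hf.fderiv (𝕜 := ℝ)).comp_left (g := fun L : Eucl n →L[ℝ] ℝ => L (EuclideanSpace.single i 1))
    (by simp)

theorem pd2_eq {n : ℕ} (f : Eucl n → ℝ) (i j : Fin n) : pd2 f i j = pd (pd f j) i := rfl

/-- A finite family of compactly supported continuous functions is uniformly equicontinuous. -/
theorem exists_uniform_modulus {n : ℕ} {ι : Type*} [Finite ι] {g : ι → Eucl n → ℝ}
    (hg : ∀ i, Continuous (g i)) (hc : ∀ i, HasCompactSupport (g i)) {ε : ℝ} (hε : 0 < ε) :
    ∃ δ > 0, ∀ i x y, dist x y < δ → dist (g i x) (g i y) ≤ ε := by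
  have h (i : ι) := Metric.uniformContinuous_iff.1
    ((hc i).uniformContinuous_of_continuous (hg i)) ε hε
  choose δ hδ hδ' using h
  cases nonempty_fintype ι
  obtain ⟨d, hd, hdle⟩ : ∃ d > 0, ∀ i, d ≤ δ i := by
    by_cases hι : Nonempty ι
    · obtain ⟨i, hi⟩ := Finite.exists_min δ
      exact ⟨δ i, hδ i, hi⟩
    · exact ⟨1, one_pos, fun i => (hι ⟨i⟩).elim⟩
  exact ⟨d, hd, fun i x y hxy => (hδ' i (hxy.trans_le (hdle i))).le⟩

/-- Smooth approximation in `C²` of a compactly supported `C²` function, with control of the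
supports. -/
theorem exists_contDiff_approx {n : ℕ} {f : Eucl n → ℝ} (hf : ContDiff ℝ 2 f)
    (hc : HasCompactSupport f) {W : Set (Eucl n)} (hW : IsOpen W) (hfW : tsupport f ⊆ W) :
    ∃ K, IsCompact K ∧ K ⊆ W ∧ tsupport f ⊆ K ∧ ∀ ε > 0, ∃ g : Eucl n → ℝ,
      ContDiff ℝ (⊤ : ℕ∞) g ∧ tsupport g ⊆ K ∧
      (∀ i x, |pd g i x - pd f i x| ≤ ε) ∧ ∀ i j x, |pd2 g i j x - pd2 f i j x| ≤ ε := by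
  obtain ⟨δ, hδ, hδW⟩ := IsCompact.exists_cthickening_subset_open hc hW hfW
  refine ⟨Metric.cthickening δ (tsupport f), IsCompact.cthickening hc, hδW,
    Metric.self_subset_cthickening _, fun ε hε => ?_⟩
  have hf1 : ContDiff ℝ 1 f := hf.of_le (by norm_num)
  have hp (i : Fin n) : ContDiff ℝ 1 (pd f i) := contDiff_pd hf (by norm_num) i
  have hpc (i : Fin n) := hasCompactSupport_pd hc i
  obtain ⟨d1, hd1, h1⟩ := exists_uniform_modulus (fun i => (hp i).continuous) hpc hε
  obtain ⟨d2, hd2, h2⟩ := exists_uniform_modulus (g := fun p : Fin n × Fin n => pd2 f p.1 p.2)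
    (fun p => (contDiff_pd (m' := 0) (hp p.2) (by norm_num) p.1).continuous)
    (fun p => hasCompactSupport_pd (hpc p.2) p.1) hε
  set r := min δ (min d1 d2) with hr
  have hr0 : 0 < r := by positivity
  let φ : ContDiffBump (0 : Eucl n) := ⟨r / 2, r, by positivity, by linarith⟩
  have hk : LocallyIntegrable (φ.normed volume) :=
    (φ.continuous_normed (μ := volume)).locallyIntegrable
  refine ⟨φ.normed volume ⋆[ContinuousLinearMap.lsmul ℝ ℝ, volume] f, ?_, ?_, ?_, ?_⟩
  · exact φ.hasCompactSupport_normed.contDiff_convolution_left _ φ.contDiff_normed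
      hf.continuous.locallyIntegrable
  · refine closure_minimal ?_ Metric.isClosed_cthickening
    refine (support_convolution_subset _).trans ?_
    rw [φ.support_normed_eq, ball_add_zero]
    refine (Metric.thickening_mono ?_ _).trans ((Metric.thickening_subset_of_subset _
      subset_closure).trans (Metric.thickening_subset_cthickening _ _))
    exact min_le_left _ _
  · intro i x
    rw [pd_convolution hk hf1 hc]
    exact φ.dist_normed_convolution_le (hp i).continuous.aestronglyMeasurable
      fun y hy => h1 i _ _ (hy.trans_le ((min_le_right _ _).trans (min_le_left _ _)))
  · intro i j x
    rw [pd2_eq, pd_convolution hk hf1 hc, pd_convolution hk (hp j) (hpc j)]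
    exact φ.dist_normed_convolution_le
      (contDiff_pd (m' := 0) (hp j) (by norm_num) i).continuous.aestronglyMeasurable
      fun y hy => h2 (i, j) _ _ (hy.trans_le ((min_le_right _ _).trans (min_le_right _ _)))

theorem pd_eq_zero_of_notMem_tsupport {n : ℕ} {f : Eucl n → ℝ} {x : Eucl n}
    (hx : x ∉ tsupport f) (i : Fin n) : pd f i x = 0 := by
  have : fderiv ℝ f x = 0 :=
    Function.notMem_support.1 fun h => hx (support_fderiv_subset ℝ h)
  simp [pd, this]

theorem tsupport_pd_subset {n : ℕ} (f : Eucl n → ℝ) (i : Fin n) :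
    tsupport (pd f i) ⊆ tsupport f :=
  closure_minimal (fun _ hx => by_contra fun h => hx (pd_eq_zero_of_notMem_tsupport h i))
    (isClosed_tsupport f)

theorem Lop_eq_zero_of_notMem_tsupport {n : ℕ} (a : Eucl n → Matrix (Fin n) (Fin n) ℝ)
    (V : Eucl n → Fin n → ℝ) {f : Eucl n → ℝ} {x : Eucl n} (hx : x ∉ tsupport f) :
    Lop a V f x = 0 := by
  have h2 (i j : Fin n) : pd2 f i j x = 0 :=
    pd_eq_zero_of_notMem_tsupport (fun h => hx (tsupport_pd_subset f j h)) i
  simp [Lop, h2, pd_eq_zero_of_notMem_tsupport hx]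

theorem continuousOn_Lop {n : ℕ} {a : Eucl n → Matrix (Fin n) (Fin n) ℝ}
    {V : Eucl n → Fin n → ℝ} {f : Eucl n → ℝ} {s : Set (Eucl n)}
    (ha : ∀ i j, ContinuousOn (fun x => a x i j) s) (hV : ContinuousOn V s)
    (hf : ContDiff ℝ 2 f) : ContinuousOn (Lop a V f) s := by
  have hp (i : Fin n) : ContDiff ℝ 1 (pd f i) := contDiff_pd hf (by norm_num) i
  have hp2 (i j : Fin n) : Continuous (pd2 f i j) :=
    (contDiff_pd (m' := 0) (hp j) (by norm_num) i).continuous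
  refine ContinuousOn.add ?_ ?_
  · exact continuousOn_finsetSum _ fun i _ => continuousOn_finsetSum _ fun j _ =>
      (ha i j).mul (hp2 i j).continuousOn
  · exact continuousOn_finsetSum _ fun i _ =>
      (continuousOn_pi.1 hV i).mul (hp i).continuous.continuousOn

theorem abs_Lop_sub_le {n : ℕ} (a : Eucl n → Matrix (Fin n) (Fin n) ℝ)
    (V : Eucl n → Fin n → ℝ) {f g : Eucl n → ℝ} {x : Eucl n} {ε : ℝ}
    (h1 : ∀ i, |pd g i x - pd f i x| ≤ ε) (h2 : ∀ i j, |pd2 g i j x - pd2 f i j x| ≤ ε) :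
    |Lop a V g x - Lop a V f x| ≤ ε * ((∑ i, ∑ j, |a x i j|) + ∑ i, |V x i|) := by
  have e : Lop a V g x - Lop a V f x = (∑ i, ∑ j, a x i j * (pd2 g i j x - pd2 f i j x)) +
      ∑ i, V x i * (pd g i x - pd f i x) := by
    simp only [Lop, mul_sub, Finset.sum_sub_distrib]
    ring
  rw [e, mul_add, Finset.mul_sum, Finset.mul_sum]
  refine (abs_add_le _ _).trans (add_le_add ?_ ?_)
  · refine (Finset.abs_sum_le_sum_abs _ _).trans (Finset.sum_le_sum fun i _ => ?_)
    rw [Finset.mul_sum]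
    refine (Finset.abs_sum_le_sum_abs _ _).trans (Finset.sum_le_sum fun j _ => ?_)
    rw [abs_mul, mul_comm]
    gcongr
    exact h2 i j
  · refine (Finset.abs_sum_le_sum_abs _ _).trans (Finset.sum_le_sum fun i _ => ?_)
    rw [abs_mul, mul_comm]
    gcongr
    exact h1 i

/-- The stationarity identity extends to compactly supported `C²` test functions. -/
theorem integral_Lop_eq_zero_of_contDiff_two {n : ℕ} {W : Set (Eucl n)} (hW : IsOpen W)
    {a : Eucl n → Matrix (Fin n) (Fin n) ℝ} {V : Eucl n → Fin n → ℝ} {u : Eucl n → ℝ}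
    (ha : ∀ i j, ContinuousOn (fun x => a x i j) W) (hV : ContinuousOn V W)
    (hu : ContinuousOn u W)
    (hu_stat : ∀ f : Eucl n → ℝ, ContDiff ℝ (⊤ : ℕ∞) f → HasCompactSupport f →
      tsupport f ⊆ W → (∫ x in W, Lop a V f x * u x) = 0)
    {f : Eucl n → ℝ} (hf : ContDiff ℝ 2 f) (hc : HasCompactSupport f) (hfW : tsupport f ⊆ W) :
    (∫ x in W, Lop a V f x * u x) = 0 := by
  obtain ⟨K, hK, hKW, hfK, happrox⟩ := exists_contDiff_approx hf hc hW hfW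
  have hcut {g : Eucl n → ℝ} (hg : tsupport g ⊆ K) :
      (∫ x in W, Lop a V g x * u x) = ∫ x in K, Lop a V g x * u x :=
    setIntegral_eq_of_subset_of_forall_sdiff_eq_zero hW.measurableSet hKW fun x hx => by
      rw [Lop_eq_zero_of_notMem_tsupport a V fun h => hx.2 (hg h), zero_mul]
  have hint {g : Eucl n → ℝ} (hg : ContDiff ℝ 2 g) :
      IntegrableOn (fun x => Lop a V g x * u x) K :=
    (((continuousOn_Lop ha hV hg).mul hu).mono hKW).integrableOn_compact hK
  have hcint : IntegrableOn
      (fun x => ((∑ i, ∑ j, |a x i j|) + ∑ i, |V x i|) * |u x|) K := by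
    refine ContinuousOn.integrableOn_compact hK (ContinuousOn.mono ?_ hKW)
    refine ContinuousOn.mul (ContinuousOn.add ?_ ?_) hu.abs
    · exact continuousOn_finsetSum _ fun i _ => continuousOn_finsetSum _ fun j _ => (ha i j).abs
    · exact continuousOn_finsetSum _ fun i _ => (continuousOn_pi.1 hV i).abs
  set C := ∫ x in K, ((∑ i, ∑ j, |a x i j|) + ∑ i, |V x i|) * |u x| with hC
  have hC0 : 0 ≤ C := integral_nonneg fun x => by positivity
  have hbound : ∀ ε > 0, |∫ x in W, Lop a V f x * u x| ≤ ε * C := by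
    intro ε hε
    obtain ⟨g, hg, hgK, h1, h2⟩ := happrox ε hε
    have hg2 : ContDiff ℝ 2 g := contDiff_infty.1 hg 2
    have hgc : HasCompactSupport g := hK.of_isClosed_subset (isClosed_tsupport g) hgK
    have h0 := hu_stat g hg hgc (hgK.trans hKW)
    rw [hcut hgK] at h0
    rw [hcut hfK, ← sub_zero (∫ x in K, Lop a V f x * u x), ← h0, abs_sub_comm,
      ← integral_sub (hint hg2) (hint hf), hC, ← integral_const_mul]
    refine (abs_integral_le_integral_abs).trans (integral_mono ((hint hg2).sub (hint hf)).abs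
      (hcint.const_mul ε) fun x => ?_)
    dsimp only
    rw [← sub_mul, abs_mul, ← mul_assoc]
    gcongr
    exact abs_Lop_sub_le a V (fun i => h1 i x) fun i j => h2 i j x
  refine abs_eq_zero.1 (le_antisymm (le_of_forall_pos_le_add fun ε hε => ?_) (abs_nonneg _))
  refine (hbound (ε / (C + 1)) (by positivity)).trans ?_
  rw [zero_add, div_mul_eq_mul_div, div_le_iff₀ (by positivity)]
  nlinarith

/-- Chain rule for the adjoint Fokker–Planck operator. -/
theorem Lop_comp {n : ℕ} (a : Eucl n → Matrix (Fin n) (Fin n) ℝ) (V : Eucl n → Fin n → ℝ)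
    {W : Set (Eucl n)} (hW : IsOpen W) {U : Eucl n → ℝ} (hU : ContDiffOn ℝ 2 U W)
    {φ ψ ψ' : ℝ → ℝ} (hφ : ∀ r, HasDerivAt φ (ψ r) r) (hψ : ∀ r, HasDerivAt ψ (ψ' r) r)
    {f : Eucl n → ℝ} (hf : Set.EqOn f (φ ∘ U) W) {x : Eucl n} (hx : x ∈ W) :
    Lop a V f x = ψ (U x) * Lop a V U x + ψ' (U x) * aQuad a U x := by
  have hUd {y : Eucl n} (hy : y ∈ W) : DifferentiableAt ℝ U y :=
    (hU.contDiffAt (hW.mem_nhds hy)).differentiableAt (by norm_num)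
  have hp {y : Eucl n} (hy : y ∈ W) (i : Fin n) : pd f i y = ψ (U y) * pd U i y := by
    have h : HasFDerivAt f (ψ (U y) • fderiv ℝ U y) y :=
      ((hφ (U y)).comp_hasFDerivAt y (hUd hy).hasFDerivAt).congr_of_eventuallyEq
        (hf.eventuallyEq_of_mem (hW.mem_nhds hy))
    simp [pd, h.fderiv]
  have hp2 (i j : Fin n) : pd2 f i j x =
      ψ' (U x) * pd U i x * pd U j x + ψ (U x) * pd2 U i j x := by
    have hUj : DifferentiableAt ℝ (pd U j) x :=
      (((hU.contDiffAt (hW.mem_nhds hx)).fderiv_right (m := 1) (by norm_num)).differentiableAt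
        one_ne_zero).clm_apply (differentiableAt_const _)
    have h : HasFDerivAt (pd f j)
        (ψ (U x) • fderiv ℝ (pd U j) x + pd U j x • ψ' (U x) • fderiv ℝ U x) x :=
      (((hψ (U x)).comp_hasFDerivAt x (hUd hx).hasFDerivAt).mul
        hUj.hasFDerivAt).congr_of_eventuallyEq
        (Filter.eventuallyEq_of_mem (hW.mem_nhds hx) fun y hy => hp hy j)
    rw [pd2_eq, pd, h.fderiv, pd2_eq]
    simp only [add_apply, smul_apply, smul_eq_mul, pd]
    ring
  simp only [Lop, aQuad, hp hx, hp2, mul_add, Finset.mul_sum, Finset.sum_add_distrib]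
  have e1 : ∑ i, ∑ j, a x i j * (ψ' (U x) * pd U i x * pd U j x) =
      ∑ i, ∑ j, ψ' (U x) * (a x i j * pd U i x * pd U j x) :=
    Finset.sum_congr rfl fun i _ => Finset.sum_congr rfl fun j _ => by ring
  have e2 : ∑ i, ∑ j, a x i j * (ψ (U x) * pd2 U i j x) =
      ∑ i, ∑ j, ψ (U x) * (a x i j * pd2 U i j x) :=
    Finset.sum_congr rfl fun i _ => Finset.sum_congr rfl fun j _ => by ring
  have e3 : ∑ i, V x i * (ψ (U x) * pd U i x) = ∑ i, ψ (U x) * (V x i * pd U i x) :=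
    Finset.sum_congr rfl fun i _ => by ring
  rw [e1, e2, e3]
  ring

/-- Extension by zero of `φ ∘ U`, where `φ` vanishes above a compact sublevel of `U`. -/
theorem contDiff_indicator_comp {n : ℕ} {W : Set (Eucl n)} (hW : IsOpen W) {U : Eucl n → ℝ}
    {m : WithTop ℕ∞} (hU : ContDiffOn ℝ m U W) {φ : ℝ → ℝ} (hφ : ContDiff ℝ m φ) {R : ℝ}
    (hφR : ∀ r, R ≤ r → φ r = 0) (hK : IsCompact {x ∈ W | U x ≤ R}) :
    ContDiff ℝ m (W.indicator (φ ∘ U)) ∧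
      tsupport (W.indicator (φ ∘ U)) ⊆ {x ∈ W | U x ≤ R} := by
  have hsupp : tsupport (W.indicator (φ ∘ U)) ⊆ {x ∈ W | U x ≤ R} := by
    refine closure_minimal (fun x hx => ?_) hK.isClosed
    obtain ⟨hxW, hx0⟩ := Set.indicator_apply_ne_zero.1 hx
    exact ⟨hxW, le_of_not_ge fun h => hx0 (hφR _ h)⟩
  refine ⟨contDiff_iff_contDiffAt.2 fun x => ?_, hsupp⟩
  by_cases hx : x ∈ W
  · exact (hφ.contDiffAt.comp x (hU.contDiffAt (hW.mem_nhds hx))).congr_of_eventuallyEq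
      ((Set.eqOn_indicator (f := φ ∘ U)).eventuallyEq_of_mem (hW.mem_nhds hx))
  · exact contDiffAt_const.congr_of_eventuallyEq
      (notMem_tsupport_iff_eventuallyEq.1 fun h => hx (hsupp h).1)

theorem continuousOn_aQuad {n : ℕ} {W : Set (Eucl n)} (hW : IsOpen W)
    {a : Eucl n → Matrix (Fin n) (Fin n) ℝ} (ha : ∀ i j, ContinuousOn (fun x => a x i j) W)
    {U : Eucl n → ℝ} (hU : ContDiffOn ℝ 2 U W) : ContinuousOn (aQuad a U) W := by
  have hp (i : Fin n) : ContinuousOn (pd U i) W :=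
    (hU.continuousOn_fderiv_of_isOpen hW (by norm_num)).clm_apply continuousOn_const
  exact continuousOn_finsetSum _ fun i _ => continuousOn_finsetSum _ fun j _ =>
    ((ha i j).mul (hp i)).mul (hp j)

/-- Testing stationarity with a function of the Lyapunov function. -/
theorem lyapunov_integral_le {n : ℕ} {W : Set (Eucl n)} (hW : IsOpen W)
    {a : Eucl n → Matrix (Fin n) (Fin n) ℝ} {V : Eucl n → Fin n → ℝ} {u : Eucl n → ℝ}
    (ha : ∀ i j, ContinuousOn (fun x => a x i j) W) (hV : ContinuousOn V W)
    (hu : ContinuousOn u W) (hu_nonneg : ∀ x ∈ W, 0 ≤ u x)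
    (hu_stat : ∀ f : Eucl n → ℝ, ContDiff ℝ (⊤ : ℕ∞) f → HasCompactSupport f →
      tsupport f ⊆ W → (∫ x in W, Lop a V f x * u x) = 0)
    {U : Eucl n → ℝ} (hU : ContDiffOn ℝ 2 U W) {ρm γ R : ℝ}
    (hK : IsCompact {x ∈ W | U x ≤ R})
    (hLyap : ∀ x ∈ W, x ∉ closure {y ∈ W | U y < ρm} → Lop a V U x ≤ -γ)
    {ψ ψ' : ℝ → ℝ} (hψ : ∀ r, HasDerivAt ψ (ψ' r) r) (hψ' : Continuous ψ')
    (hψ_nonneg : ∀ r, 0 ≤ ψ r) (hψ_low : ∀ r ≤ ρm, ψ r = 0) (hψ_high : ∀ r, R ≤ r → ψ r = 0) :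
    (∫ x in {x ∈ W | U x ≤ R}, (γ * ψ (U x) - ψ' (U x) * aQuad a U x) * u x) ≤ 0 := by
  set K := {x ∈ W | U x ≤ R} with hKdef
  have hKW : K ⊆ W := Set.sep_subset _ _
  have hψc : Continuous ψ := continuous_iff_continuousAt.2 fun r => (hψ r).continuousAt
  have hψ1 : ContDiff ℝ 1 ψ := by
    refine contDiff_one_iff_deriv.2 ⟨fun r => (hψ r).differentiableAt, ?_⟩
    rwa [funext fun r => (hψ r).deriv]
  let φ : ℝ → ℝ := fun r => ∫ t in R..r, ψ t
  have hφ (r : ℝ) : HasDerivAt φ (ψ r) r := hψc.integral_hasStrictDerivAt R r |>.hasDerivAt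
  have hφ2 : ContDiff ℝ 2 φ := by
    refine (contDiff_succ_iff_deriv (n := 1)).2
      ⟨fun r => (hφ r).differentiableAt, by simp, ?_⟩
    rwa [funext fun r => (hφ r).deriv]
  have hφR (r : ℝ) (hr : R ≤ r) : φ r = 0 := by
    refine intervalIntegral.integral_zero_ae (.of_forall fun t ht => hψ_high t ?_)
    rw [Set.uIoc_of_le hr] at ht
    exact ht.1.le
  obtain ⟨hf, hfK⟩ := contDiff_indicator_comp hW hU hφ2 hφR hK
  have hfc : HasCompactSupport (W.indicator (φ ∘ U)) :=
    hK.of_isClosed_subset (isClosed_tsupport _) hfK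
  have h0 := integral_Lop_eq_zero_of_contDiff_two hW ha hV hu hu_stat hf hfc (hfK.trans hKW)
  rw [setIntegral_eq_of_subset_of_forall_sdiff_eq_zero hW.measurableSet hKW fun x hx => by
    rw [Lop_eq_zero_of_notMem_tsupport a V fun h => hx.2 (hfK h), zero_mul]] at h0
  have hUc : ContinuousOn U W := hU.continuousOn
  have hi1 : IntegrableOn (fun x => Lop a V (W.indicator (φ ∘ U)) x * u x) K :=
    (((continuousOn_Lop ha hV hf).mul hu).mono hKW).integrableOn_compact hK
  have hi2 : IntegrableOn (fun x => (γ * ψ (U x) - ψ' (U x) * aQuad a U x) * u x) K := by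
    refine ContinuousOn.integrableOn_compact hK (ContinuousOn.mono ?_ hKW)
    exact (((hψc.comp_continuousOn hUc).const_mul γ).sub
      ((hψ'.comp_continuousOn hUc).mul (continuousOn_aQuad hW ha hU))).mul hu
  suffices h : (∫ x in K, (γ * ψ (U x) - ψ' (U x) * aQuad a U x) * u x) ≤
      ∫ x in K, -(Lop a V (W.indicator (φ ∘ U)) x * u x) by
    rwa [integral_neg, h0, neg_zero] at h
  refine setIntegral_mono_on hi2 hi1.neg hK.measurableSet fun x hx => ?_
  rw [Lop_comp a V hW hU hφ hψ Set.eqOn_indicator (hKW hx), ← neg_mul]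
  refine mul_le_mul_of_nonneg_right ?_ (hu_nonneg x (hKW hx))
  have hle : ψ (U x) * Lop a V U x ≤ ψ (U x) * -γ := by
    rcases le_or_gt (U x) ρm with h | h
    · simp [hψ_low _ h]
    · refine mul_le_mul_of_nonneg_left (hLyap x (hKW hx) fun hcl => ?_) (hψ_nonneg _)
      have hn : {y | ρm < U y} ∈ nhds x :=
        (hUc.continuousAt (hW.mem_nhds (hKW hx))).eventually (lt_mem_nhds h)
      obtain ⟨y, hy1, hy2⟩ := mem_closure_iff_nhds.1 hcl _ hn
      exact lt_asymm hy1 hy2.2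
  linarith

/-- A weighted pushforward to the line, characterised by its integrals. -/
theorem exists_weighted_pushforward {X : Type*} [MeasurableSpace X] {μ : Measure X}
    {U w : X → ℝ} (hU : AEMeasurable U μ) (hw : Integrable w μ) (hw0 : 0 ≤ᵐ[μ] w) :
    ∃ α : Measure ℝ, IsFiniteMeasure α ∧ ∀ G : ℝ → ℝ, Measurable G →
      (Integrable G α ↔ Integrable (fun x => G (U x) * w x) μ) ∧
        ∫ r, G r ∂α = ∫ x, G (U x) * w x ∂μ := by
  set κ := μ.withDensity fun x => ENNReal.ofReal (w x) with hκ
  have hfin : IsFiniteMeasure κ := isFiniteMeasure_withDensity_ofReal hw.2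
  have hUκ : AEMeasurable U κ := hU.mono_ac (withDensity_absolutelyContinuous _ _)
  have hwm : AEMeasurable (fun x => ENNReal.ofReal (w x)) μ :=
    hw.aestronglyMeasurable.aemeasurable.ennreal_ofReal
  have hlt : ∀ᵐ x ∂μ, ENNReal.ofReal (w x) < ⊤ := .of_forall fun _ => ENNReal.ofReal_lt_top
  have he (G : ℝ → ℝ) : (fun x => (ENNReal.ofReal (w x)).toReal • G (U x)) =ᵐ[μ]
      fun x => G (U x) * w x := by
    filter_upwards [hw0] with x hx
    rw [ENNReal.toReal_ofReal hx, smul_eq_mul, mul_comm]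
  refine ⟨κ.map U, inferInstance, fun G hG => ⟨?_, ?_⟩⟩
  · rw [integrable_map_measure hG.aestronglyMeasurable hUκ, hκ,
      integrable_withDensity_iff_integrable_smul₀' hwm hlt]
    exact integrable_congr (he G)
  · rw [integral_map hUκ hG.aestronglyMeasurable, hκ,
      integral_withDensity_eq_integral_toReal_smul₀ hwm hlt]
    exact integral_congr_ae (he G)

/-- `L¹` approximation on the line of a nonnegative function supported in `[s, ∞)` by continuous
nonnegative functions supported in `[r₀, ∞)`, for `r₀ < s`. -/
theorem exists_continuous_nonneg_approx {ν : Measure ℝ} [ν.Regular] {h : ℝ → ℝ}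
    (hh : Integrable h ν) (hh0 : ∀ r, 0 ≤ h r) {r₀ s : ℝ} (hs : r₀ < s)
    (hhs : ∀ r < s, h r = 0) {ε : ℝ} (hε : 0 < ε) :
    ∃ f : ℝ → ℝ, Continuous f ∧ (∀ r, 0 ≤ f r) ∧ (∀ r ≤ r₀, f r = 0) ∧
      Integrable (fun r => |f r - h r|) ν ∧ ∫ r, |f r - h r| ∂ν ≤ ε := by
  obtain ⟨g, -, hgε, hgc, hgi⟩ := hh.exists_hasCompactSupport_integral_sub_le hε
  let χ : ℝ → ℝ := fun r => min 1 (max 0 ((r - r₀) / (s - r₀)))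
  have hχc : Continuous χ := by fun_prop
  have hχ0 (r : ℝ) : 0 ≤ χ r := by positivity
  have hχ1 (r : ℝ) : χ r ≤ 1 := min_le_left _ _
  have hχs (r : ℝ) (hr : s ≤ r) : χ r = 1 := by
    refine min_eq_left (le_max_of_le_right ?_)
    rw [le_div_iff₀ (by linarith)]
    linarith
  have hχr (r : ℝ) (hr : r ≤ r₀) : χ r = 0 := by
    have : (r - r₀) / (s - r₀) ≤ 0 :=
      div_nonpos_of_nonpos_of_nonneg (by linarith) (by linarith)
    simp [χ, this]
  have hc : Continuous fun r => χ r * max (g r) 0 := by fun_prop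
  have hle (r : ℝ) : |χ r * max (g r) 0 - h r| ≤ ‖h r - g r‖ := by
    rw [Real.norm_eq_abs]
    rcases lt_or_ge r s with hr | hr
    · rw [hhs r hr, sub_zero, zero_sub, abs_neg, abs_mul, abs_of_nonneg (hχ0 r)]
      have : |max (g r) 0| ≤ |g r| := by
        rw [abs_of_nonneg (le_max_right _ _)]
        exact max_le (le_abs_self _) (abs_nonneg _)
      nlinarith [hχ0 r, hχ1 r, abs_nonneg (g r), abs_nonneg (max (g r) 0)]
    · rw [hχs r hr, one_mul, abs_sub_comm (h r)]
      have := abs_max_sub_max_le_abs (g r) (h r) 0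
      rwa [max_eq_left (hh0 r)] at this
  have hi : Integrable (fun r => |χ r * max (g r) 0 - h r|) ν :=
    (hh.sub hgi).norm.mono' (hc.aestronglyMeasurable.sub hh.1).norm
      (.of_forall fun r => by simpa using hle r)
  exact ⟨_, hc, fun r => mul_nonneg (hχ0 r) (le_max_right _ _), fun r hr => by simp [hχr r hr],
    hi, (integral_mono hi (hh.sub hgi).norm hle).trans hgε⟩

/-- A `C¹` cutoff equal to `1` below `R` and to `0` above `T`. -/
theorem exists_antitone_cutoff {R T : ℝ} (h : R < T) :
    ∃ θ : ℝ → ℝ, ContDiff ℝ 1 θ ∧ Antitone θ ∧ (∀ r, 0 ≤ θ r) ∧ (∀ r, θ r ≤ 1) ∧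
      (∀ r ≤ R, θ r = 1) ∧ ∀ r, T ≤ r → θ r = 0 := by
  refine ⟨fun r => Real.smoothTransition ((T - r) / (T - R)),
    Real.smoothTransition.contDiff.comp (by fun_prop), fun x y hxy => ?_,
    fun r => Real.smoothTransition.nonneg _, fun r => Real.smoothTransition.le_one _,
    fun r hr => Real.smoothTransition.one_of_one_le ?_,
    fun r hr => Real.smoothTransition.zero_of_nonpos ?_⟩
  · refine Real.smoothTransition.monotone ?_
    have : 0 < T - R := by linarith
    gcongr
  · rw [le_div_iff₀ (by linarith)]
    linarith
  · exact div_nonpos_of_nonpos_of_nonneg (by linarith) (by linarith)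

/-- The pointwise inequality behind the exponential decay estimate. -/
theorem cutoff_pointwise_le {γ A f h e θ θ' E M : ℝ} (hγ : 0 < γ) (hA : 0 ≤ A)
    (hhA : h * A ≤ 1) (he : 1 ≤ e) (hθ0 : 0 ≤ θ) (hθ1 : θ ≤ 1) (hθ' : θ' ≤ 0) (heM : e ≤ M)
    (hE : E ≤ 0 ∨ h = 0 ∧ E ≤ 1 + (e - 1) * θ) :
    E ≤ 1 + γ⁻¹ * (γ * ((e - 1) * θ) - (γ * f * e * θ + (e - 1) * θ') * A) +
      M * (|f - h| * A) := by
  have h1 : γ⁻¹ * (γ * ((e - 1) * θ) - (γ * f * e * θ + (e - 1) * θ') * A) =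
      (e - 1) * θ - f * e * θ * A + γ⁻¹ * ((e - 1) * (-θ') * A) := by
    field_simp
    ring
  have h2 : 0 ≤ γ⁻¹ * ((e - 1) * (-θ') * A) := by
    have : 0 ≤ e - 1 := by linarith
    have : 0 ≤ -θ' := by linarith
    positivity
  have h3 : (f - h) * (e * θ * A) ≤ |f - h| * (M * A) := by
    have : e * θ ≤ M := by nlinarith
    gcongr
    exact le_abs_self _
  have h4 : f * e * θ * A - M * (|f - h| * A) ≤ h * A * (e * θ) := by linarith
  have h5 : h * A * (e * θ) ≤ e * θ := by
    have : 0 ≤ e * θ := by positivity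
    nlinarith
  rcases hE with hE | ⟨rfl, hE⟩
  · linarith
  · linarith [h4.trans_eq (by ring : (0 : ℝ) * A * (e * θ) = 0)]

/-- Exponential decay of the mass between two levels, up to an approximation error. -/
theorem exp_mul_setIntegral_le_add {n : ℕ} {W : Set (Eucl n)} (hW : IsOpen W)
    {a : Eucl n → Matrix (Fin n) (Fin n) ℝ} {V : Eucl n → Fin n → ℝ} {u : Eucl n → ℝ}
    (ha : ∀ i j, ContinuousOn (fun x => a x i j) W) (hV : ContinuousOn V W)
    (hu : ContinuousOn u W) (hu_nonneg : ∀ x ∈ W, 0 ≤ u x)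
    (hu_stat : ∀ f : Eucl n → ℝ, ContDiff ℝ (⊤ : ℕ∞) f → HasCompactSupport f →
      tsupport f ⊆ W → (∫ x in W, Lop a V f x * u x) = 0)
    {U : Eucl n → ℝ} (hU : ContDiffOn ℝ 2 U W) (hA : ∀ x ∈ W, 0 ≤ aQuad a U x)
    {ρm s ρ R T γ : ℝ} (hs : ρm < s) (hsρ : s ≤ ρ) (hρR : ρ ≤ R) (hRT : R < T) (hγ : 0 < γ)
    (hK : IsCompact {x ∈ W | U x ≤ T}) (hmass : (∫ x in {x ∈ W | U x ≤ T}, u x) ≤ 1)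
    (hLyap : ∀ x ∈ W, x ∉ closure {y ∈ W | U y < ρm} → Lop a V U x ≤ -γ)
    {H : ℝ → ℝ} (hH_meas : Measurable H) (hH_up : ∀ x ∈ W, aQuad a U x ≤ H (U x))
    (hH_pos : ∀ t ∈ Set.Ioo s ρ, 0 < H t)
    (hH_int : IntervalIntegrable (fun t => 1 / H t) volume s ρ) {ε : ℝ} (hε : 0 < ε) :
    Real.exp (γ * ((∫ t in s..ρ, 1 / H t) - ε)) * (∫ x in {x ∈ W | ρ ≤ U x ∧ U x ≤ R}, u x) ≤
      1 + Real.exp (γ * ((∫ t in s..ρ, 1 / H t) + ε)) * ε := by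
  set K := {x ∈ W | U x ≤ T} with hKdef
  set I := ∫ t in s..ρ, 1 / H t with hI
  have hKW : K ⊆ W := Set.sep_subset _ _
  have hUc : ContinuousOn U W := hU.continuousOn
  have hAc : ContinuousOn (aQuad a U) W := continuousOn_aQuad hW ha hU
  have hUK : AEMeasurable U (volume.restrict K) := (hUc.mono hKW).aemeasurable hK.measurableSet
  have huK : IntegrableOn u K := (hu.mono hKW).integrableOn_compact hK
  have hAuK : IntegrableOn (fun x => aQuad a U x * u x) K :=
    ((hAc.mul hu).mono hKW).integrableOn_compact hK
  obtain ⟨α, hα, hαG⟩ := exists_weighted_pushforward hUK hAuK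
    ((ae_restrict_iff' hK.measurableSet).2 (.of_forall fun x hx =>
      mul_nonneg (hA x (hKW hx)) (hu_nonneg x (hKW hx))))
  set h : ℝ → ℝ := (Set.Ioo s ρ).indicator fun t => 1 / H t with hh
  have hhm : Measurable h := (measurable_const.div hH_meas).indicator measurableSet_Ioo
  have hh0 (r : ℝ) : 0 ≤ h r :=
    Set.indicator_nonneg (fun t ht => one_div_nonneg.2 (hH_pos t ht).le) r
  have hhA (x : Eucl n) (hx : x ∈ W) : h (U x) * aQuad a U x ≤ 1 := by
    by_cases hr : U x ∈ Set.Ioo s ρ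
    · rw [hh, Set.indicator_of_mem hr, one_div_mul_eq_div, div_le_one (hH_pos _ hr)]
      exact hH_up x hx
    · simp [hh, Set.indicator_of_notMem hr]
  have hhI : IntegrableOn (fun t => 1 / H t) (Set.Ioo s ρ) :=
    ((intervalIntegrable_iff_integrableOn_Ioc_of_le hsρ).1 hH_int).mono_set
      Set.Ioo_subset_Ioc_self
  have hhvol : Integrable h volume := hhI.integrable_indicator measurableSet_Ioo
  have hhset {b : ℝ} (hb : ρ ≤ b) : ∫ t in Set.Ioc ρm b, h t = I := by
    rw [hh, setIntegral_indicator measurableSet_Ioo, hI, intervalIntegral.integral_of_le hsρ,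
      integral_Ioc_eq_integral_Ioo, Set.inter_eq_self_of_subset_right]
    exact fun t ht => ⟨hs.trans ht.1, ht.2.le.trans hb⟩
  have hhα : Integrable h α := by
    refine (hαG h hhm).1.2 (huK.mono' ((hhm.comp_aemeasurable hUK).aestronglyMeasurable.mul
      hAuK.1) ((ae_restrict_iff' hK.measurableSet).2 (.of_forall fun x hx => ?_)))
    have hAx := hA x (hKW hx)
    have hux := hu_nonneg x (hKW hx)
    rw [Real.norm_of_nonneg (mul_nonneg (hh0 _) (mul_nonneg hAx hux)), ← mul_assoc]
    exact mul_le_of_le_one_left hux (hhA x (hKW hx))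
  obtain ⟨f, hfc, hf0, hfm, hfi, hfε⟩ := exists_continuous_nonneg_approx
    (ν := volume.restrict (Set.Ioc ρm T) + α) (hhvol.restrict.add_measure hhα) hh0 hs
    (fun r hr => Set.indicator_of_notMem (fun h => hr.not_gt h.1) _) hε
  have hfi1 : IntegrableOn (fun r => |f r - h r|) (Set.Ioc ρm T) := hfi.left_of_add_measure
  have hfi2 : Integrable (fun r => |f r - h r|) α := hfi.right_of_add_measure
  have hdm : Measurable fun r => |f r - h r| := (hfc.measurable.sub hhm).abs
  rw [integral_add_measure hfi1 hfi2, (hαG _ hdm).2] at hfε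
  have hdK : IntegrableOn (fun x => |f (U x) - h (U x)| * (aQuad a U x * u x)) K :=
    (hαG _ hdm).1.1 hfi2
  have hd1 : 0 ≤ ∫ r in Set.Ioc ρm T, |f r - h r| := integral_nonneg fun _ => abs_nonneg _
  have hd2 : 0 ≤ ∫ x in K, |f (U x) - h (U x)| * (aQuad a U x * u x) :=
    setIntegral_nonneg hK.measurableSet fun x hx =>
      mul_nonneg (abs_nonneg _) (mul_nonneg (hA x (hKW hx)) (hu_nonneg x (hKW hx)))
  -- the primitive of `f`
  let F : ℝ → ℝ := fun r => ∫ t in ρm..r, f t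
  have hF (r : ℝ) : HasDerivAt F (f r) r := (hfc.integral_hasStrictDerivAt ρm r).hasDerivAt
  have hFc : Continuous F := continuous_iff_continuousAt.2 fun r => (hF r).continuousAt
  have hFmono : Monotone F := monotone_of_hasDerivAt_nonneg hF hf0
  have hFlow (r : ℝ) (hr : r ≤ ρm) : F r = 0 := by
    refine intervalIntegral.integral_zero_ae (.of_forall fun t ht => hfm t ?_)
    rw [Set.uIoc_of_ge hr] at ht
    exact ht.2
  have hF0 (r : ℝ) : 0 ≤ F r := by
    rcases le_total r ρm with hr | hr
    · rw [hFlow r hr]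
    · rw [← hFlow ρm le_rfl]
      exact hFmono hr
  have hFabs {b : ℝ} (hb : ρ ≤ b) (hbT : b ≤ T) : |F b - I| ≤ ε := by
    have hsub : Set.Ioc ρm b ⊆ Set.Ioc ρm T := Set.Ioc_subset_Ioc_right hbT
    rw [← hhset hb, show F b = ∫ t in Set.Ioc ρm b, f t from
      intervalIntegral.integral_of_le (by linarith), ← integral_sub hfc.integrableOn_Ioc
      hhvol.restrict]
    refine abs_integral_le_integral_abs.trans ((setIntegral_mono_set hfi1
      (.of_forall fun _ => abs_nonneg _) hsub.eventuallyLE).trans ?_)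
    linarith
  obtain ⟨θ, hθ, hθa, hθ0, hθ1, hθR, hθT⟩ := exists_antitone_cutoff hRT
  have hθd (r : ℝ) : HasDerivAt θ (deriv θ r) r :=
    (hθ.differentiable one_ne_zero r).hasDerivAt
  have hψd (r : ℝ) : HasDerivAt (fun r => (Real.exp (γ * F r) - 1) * θ r)
      (γ * f r * Real.exp (γ * F r) * θ r + (Real.exp (γ * F r) - 1) * deriv θ r) r := by
    refine ((((hF r).const_mul γ).exp.sub_const 1).mul (hθd r)).congr_deriv ?_
    ring
  have hθ'c : Continuous (deriv θ) := hθ.continuous_deriv le_rfl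
  have hψ'c : Continuous fun r =>
      γ * f r * Real.exp (γ * F r) * θ r + (Real.exp (γ * F r) - 1) * deriv θ r := by
    have := hθ.continuous
    fun_prop
  have hψc : Continuous fun r => (Real.exp (γ * F r) - 1) * θ r :=
    continuous_iff_continuousAt.2 fun r => (hψd r).continuousAt
  have hexp1 (r : ℝ) : 1 ≤ Real.exp (γ * F r) := Real.one_le_exp (mul_nonneg hγ.le (hF0 r))
  have hmain := lyapunov_integral_le hW ha hV hu hu_nonneg hu_stat hU hK hLyap hψd hψ'c
    (fun r => mul_nonneg (by linarith [hexp1 r]) (hθ0 r)) (fun r hr => by simp [hFlow r hr])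
    (fun r hr => by simp [hθT r hr])
  set G : Eucl n → ℝ := fun x => (γ * ((Real.exp (γ * F (U x)) - 1) * θ (U x)) -
    (γ * f (U x) * Real.exp (γ * F (U x)) * θ (U x) +
      (Real.exp (γ * F (U x)) - 1) * deriv θ (U x)) * aQuad a U x) * u x with hG
  have hGi : IntegrableOn G K := by
    refine ContinuousOn.integrableOn_compact hK (ContinuousOn.mono ?_ hKW)
    exact (((hψc.comp_continuousOn hUc).const_mul γ).sub
      ((hψ'c.comp_continuousOn hUc).mul hAc)).mul hu
  set M := Real.exp (γ * (I + ε)) with hM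
  set S := {x ∈ W | ρ ≤ U x ∧ U x ≤ R} with hS
  have hSK : S ⊆ K := fun x hx => ⟨hx.1, hx.2.2.trans hRT.le⟩
  have hSm : MeasurableSet S := by
    have : S = K ∩ (K ∩ U ⁻¹' Set.Icc ρ R) := by
      ext x
      exact ⟨fun hx => ⟨hSK hx, hSK hx, hx.2⟩, fun hx => ⟨hx.1.1, hx.2.2⟩⟩
    rw [this]
    exact hK.measurableSet.inter
      ((hUc.mono hKW).preimage_isClosed_of_isClosed hK.isClosed isClosed_Icc).measurableSet
  have hEi : IntegrableOn (fun x => S.indicator (fun _ => Real.exp (γ * F ρ)) x * u x) K := by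
    simp_rw [Set.indicator_mul_left S (fun _ => Real.exp (γ * F ρ)) u |>.symm]
    exact (huK.const_mul _).indicator hSm
  have hpt (x : Eucl n) (hx : x ∈ K) : S.indicator (fun _ => Real.exp (γ * F ρ)) x * u x ≤
      u x + γ⁻¹ * G x + M * (|f (U x) - h (U x)| * (aQuad a U x * u x)) := by
    have hxW := hKW hx
    have key := mul_le_mul_of_nonneg_right (cutoff_pointwise_le (f := f (U x))
      (θ' := deriv θ (U x))
      (E := S.indicator (fun _ => Real.exp (γ * F ρ)) x) (M := M) hγ (hA x hxW)
      (hhA x hxW) (hexp1 (U x)) (hθ0 (U x)) (hθ1 (U x)) hθa.deriv_nonpos ?_ ?_)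
      (hu_nonneg x hxW)
    · refine key.trans_eq ?_
      rw [hG]
      ring
    · refine Real.exp_le_exp.2 (mul_le_mul_of_nonneg_left ?_ hγ.le)
      linarith [hFmono hx.2, (abs_le.1 (hFabs (hρR.trans hRT.le) le_rfl)).2]
    · rcases lt_or_ge (U x) ρ with hr | hr
      · exact .inl (Set.indicator_of_notMem (fun hxS => hr.not_ge hxS.2.1) _).le
      · refine .inr ⟨Set.indicator_of_notMem (fun hm => hr.not_gt hm.2) _, ?_⟩
        by_cases hxS : x ∈ S
        · rw [Set.indicator_of_mem hxS, hθR _ hxS.2.2, mul_one, add_sub_cancel]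
          exact Real.exp_le_exp.2 (mul_le_mul_of_nonneg_left (hFmono hr) hγ.le)
        · rw [Set.indicator_of_notMem hxS]
          nlinarith [hexp1 (U x), hθ0 (U x)]
  have hui : IntegrableOn (fun x => u x + γ⁻¹ * G x) K := huK.add (hGi.const_mul γ⁻¹)
  have hsum : ∫ x in K, u x + γ⁻¹ * G x + M * (|f (U x) - h (U x)| * (aQuad a U x * u x)) =
      (∫ x in K, u x) + γ⁻¹ * (∫ x in K, G x) +
        M * ∫ x in K, |f (U x) - h (U x)| * (aQuad a U x * u x) := by
    rw [integral_add hui (hdK.const_mul M), integral_add huK (hGi.const_mul γ⁻¹),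
      integral_const_mul, integral_const_mul]
  have hint := setIntegral_mono_on hEi (hui.add (hdK.const_mul M))
    hK.measurableSet hpt
  have hEeq : ∫ x in K, S.indicator (fun _ => Real.exp (γ * F ρ)) x * u x =
      Real.exp (γ * F ρ) * ∫ x in S, u x := by
    simp_rw [Set.indicator_mul_left S (fun _ => Real.exp (γ * F ρ)) u |>.symm]
    rw [setIntegral_indicator hSm, Set.inter_eq_self_of_subset_right hSK, integral_const_mul]
  rw [hEeq] at hint
  replace hint := hint.trans_eq hsum
  have hS0 : 0 ≤ ∫ x in S, u x := setIntegral_nonneg hSm fun x hx => hu_nonneg x hx.1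
  calc Real.exp (γ * (I - ε)) * ∫ x in S, u x
      ≤ Real.exp (γ * F ρ) * ∫ x in S, u x := by
        have := (abs_le.1 (hFabs le_rfl (hρR.trans hRT.le))).1
        gcongr
        linarith
    _ ≤ 1 + M * ε := by
        have h1 : γ⁻¹ * ∫ x in K, G x ≤ 0 :=
          mul_nonpos_of_nonneg_of_nonpos (inv_nonneg.2 hγ.le) hmain
        have h2 : M * ∫ x in K, |f (U x) - h (U x)| * (aQuad a U x * u x) ≤ M * ε :=
          mul_le_mul_of_nonneg_left (by linarith) (Real.exp_nonneg _)
        linarith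

/-- Exponential decay of the mass between two levels. -/
theorem exp_mul_setIntegral_le {n : ℕ} {W : Set (Eucl n)} (hW : IsOpen W)
    {a : Eucl n → Matrix (Fin n) (Fin n) ℝ} {V : Eucl n → Fin n → ℝ} {u : Eucl n → ℝ}
    (ha : ∀ i j, ContinuousOn (fun x => a x i j) W) (hV : ContinuousOn V W)
    (hu : ContinuousOn u W) (hu_nonneg : ∀ x ∈ W, 0 ≤ u x)
    (hu_stat : ∀ f : Eucl n → ℝ, ContDiff ℝ (⊤ : ℕ∞) f → HasCompactSupport f →
      tsupport f ⊆ W → (∫ x in W, Lop a V f x * u x) = 0)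
    {U : Eucl n → ℝ} (hU : ContDiffOn ℝ 2 U W) (hA : ∀ x ∈ W, 0 ≤ aQuad a U x)
    {ρm s ρ R T γ : ℝ} (hs : ρm < s) (hsρ : s ≤ ρ) (hρR : ρ ≤ R) (hRT : R < T) (hγ : 0 < γ)
    (hK : IsCompact {x ∈ W | U x ≤ T}) (hmass : (∫ x in {x ∈ W | U x ≤ T}, u x) ≤ 1)
    (hLyap : ∀ x ∈ W, x ∉ closure {y ∈ W | U y < ρm} → Lop a V U x ≤ -γ)
    {H : ℝ → ℝ} (hH_meas : Measurable H) (hH_up : ∀ x ∈ W, aQuad a U x ≤ H (U x))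
    (hH_pos : ∀ t ∈ Set.Ioo s ρ, 0 < H t)
    (hH_int : IntervalIntegrable (fun t => 1 / H t) volume s ρ) :
    Real.exp (γ * ∫ t in s..ρ, 1 / H t) * (∫ x in {x ∈ W | ρ ≤ U x ∧ U x ≤ R}, u x) ≤ 1 := by
  set I := ∫ t in s..ρ, 1 / H t with hI
  set N := ∫ x in {x ∈ W | ρ ≤ U x ∧ U x ≤ R}, u x with hN
  have hl : Filter.Tendsto (fun ε => Real.exp (γ * (I - ε)) * N) (nhdsWithin 0 (Set.Ioi 0))
      (nhds (Real.exp (γ * (I - 0)) * N)) :=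
    Continuous.tendsto' (by fun_prop) _ _ rfl |>.mono_left nhdsWithin_le_nhds
  have hr : Filter.Tendsto (fun ε => 1 + Real.exp (γ * (I + ε)) * ε) (nhdsWithin 0 (Set.Ioi 0))
      (nhds (1 + Real.exp (γ * (I + 0)) * 0)) :=
    Continuous.tendsto' (by fun_prop) _ _ rfl |>.mono_left nhdsWithin_le_nhds
  have := le_of_tendsto_of_tendsto hl hr (eventually_mem_nhdsWithin.mono fun ε hε =>
    exp_mul_setIntegral_le_add hW ha hV hu hu_nonneg hu_stat hU hA hs hsρ hρR hRT hγ hK hmass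
      hLyap hH_meas hH_up hH_pos hH_int hε)
  simpa using this

/-- **Theorem A(b)**. -/
theorem thmA_b
    {n : ℕ} (hn : 0 < n)
    (𝒰 : Set (Eucl n)) (hUopen : IsOpen 𝒰) (hUconn : IsConnected 𝒰)
    (a : Eucl n → Matrix (Fin n) (Fin n) ℝ)
    (ha_C1 : ∀ i j, ContDiffOn ℝ 1 (fun x => a x i j) 𝒰)
    (ha_symm : ∀ x ∈ 𝒰, ∀ i j, a x i j = a x j i)
    (ha_psd : ∀ x ∈ 𝒰, ∀ v : Fin n → ℝ, 0 ≤ ∑ i, ∑ j, a x i j * v i * v j)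
    (V : Eucl n → Fin n → ℝ) (hV_cont : ContinuousOn V 𝒰)
    (u : Eucl n → ℝ) (hu_C1 : ContDiffOn ℝ 1 u 𝒰) (hu_nonneg : ∀ x ∈ 𝒰, 0 ≤ u x)
    (hu_mass : (∫ x in 𝒰, u x) = 1)
    (hu_stat : ∀ f : Eucl n → ℝ, ContDiff ℝ (⊤ : ℕ∞) f → HasCompactSupport f →
      tsupport f ⊆ 𝒰 → (∫ x in 𝒰, Lop a V f x * u x) = 0)
    (U : Eucl n → ℝ) (ρM : EReal) (hU_C2 : ContDiffOn ℝ 2 U 𝒰)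
    (hU_nonneg : ∀ x ∈ 𝒰, 0 ≤ U x)
    (hU_lt : ∀ x ∈ 𝒰, (U x : EReal) < ρM)
    (hU_sup : ρM = ⨆ x : 𝒰, (U x.1 : EReal))
    (hU_cpt : ∀ ρ : ℝ, (ρ : EReal) < ρM → IsCompact {x ∈ 𝒰 | U x ≤ ρ})
    (ρm γ : ℝ) (hρm_pos : 0 < ρm) (hρm_lt : (ρm : EReal) < ρM) (hγ : 0 < γ)
    (hLyap : ∀ x ∈ 𝒰, x ∉ closure {y ∈ 𝒰 | U y < ρm} → Lop a V U x ≤ -γ)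
    (H : ℝ → ℝ) (hH_meas : Measurable H)
    (hH_nonneg : ∀ t : ℝ, 0 ≤ t → (t : EReal) < ρM → 0 ≤ H t)
    (hH_locbdd : ∀ ρ : ℝ, (ρ : EReal) < ρM → BddAbove (H '' Set.Icc 0 ρ))
    (hH_up : ∀ x ∈ 𝒰, aQuad a U x ≤ H (U x))
    (hH_pos : ∀ t : ℝ, ρm ≤ t → (t : EReal) < ρM → 0 < H t)
    (hR : ∀ᵐ r ∂(volume.restrict {t : ℝ | ρm ≤ t ∧ (t : EReal) < ρM}),
      ∀ x ∈ 𝒰, U x = r → gradient U x ≠ 0)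
    :
    ∀ ρ : ℝ, ρm ≤ ρ → (ρ : EReal) < ρM →
      (∫ x in {x ∈ 𝒰 | ρ ≤ U x}, u x) ≤ Real.exp (-γ * ∫ t in ρm..ρ, 1 / H t) := by
  intro ρ hρ hρM
  have hui : IntegrableOn u 𝒰 := by
    by_contra h
    rw [integral_undef h] at hu_mass
    exact zero_ne_one hu_mass
  have hu0 : 0 ≤ᵐ[volume.restrict 𝒰] u :=
    (ae_restrict_iff' hUopen.measurableSet).2 (.of_forall hu_nonneg)
  have hsub_le {S : Set (Eucl n)} (hS : S ⊆ 𝒰) : ∫ x in S, u x ≤ 1 :=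
    hu_mass ▸ setIntegral_mono_set hui hu0 hS.eventuallyLE
  have htriv (h : ∫ t in ρm..ρ, 1 / H t = 0) :
      (∫ x in {x ∈ 𝒰 | ρ ≤ U x}, u x) ≤ Real.exp (-γ * ∫ t in ρm..ρ, 1 / H t) := by
    rw [h, mul_zero, Real.exp_zero]
    exact hsub_le (Set.sep_subset _ _)
  rcases hρ.eq_or_lt with rfl | hρlt
  · exact htriv intervalIntegral.integral_same
  by_cases hHi : IntervalIntegrable (fun t => 1 / H t) volume ρm ρ
  swap
  · exact htriv (intervalIntegral.integral_undef hHi)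
  have ha (i j : Fin n) : ContinuousOn (fun x => a x i j) 𝒰 := (ha_C1 i j).continuousOn
  have hA (x : Eucl n) (hx : x ∈ 𝒰) : 0 ≤ aQuad a U x := ha_psd x hx fun i => pd U i x
  have hlevel {R : ℝ} (hρR : ρ ≤ R) (hRM : (R : EReal) < ρM) :
      (∫ x in {x ∈ 𝒰 | ρ ≤ U x ∧ U x ≤ R}, u x) ≤ Real.exp (-γ * ∫ t in ρm..ρ, 1 / H t) := by
    obtain ⟨T, hRT, hTM⟩ := EReal.lt_iff_exists_real_btwn.1 hRM
    have hs : ∀ s ∈ Set.Ioo ρm ρ, Real.exp (γ * ∫ t in s..ρ, 1 / H t) *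
        (∫ x in {x ∈ 𝒰 | ρ ≤ U x ∧ U x ≤ R}, u x) ≤ 1 := fun s hs =>
      exp_mul_setIntegral_le hUopen ha hV_cont hu_C1.continuousOn hu_nonneg hu_stat hU_C2 hA
        hs.1 hs.2.le hρR (EReal.coe_lt_coe_iff.1 hRT) hγ (hU_cpt T hTM)
        (hsub_le (Set.sep_subset _ _)) hLyap hH_meas hH_up
        (fun t ht => hH_pos t (hs.1.trans ht.1).le
          ((EReal.coe_lt_coe_iff.2 ht.2).trans hρM))
        (hHi.mono_set (by
          rw [Set.uIcc_of_le hs.2.le, Set.uIcc_of_le hρ]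
          exact Set.Icc_subset_Icc_left hs.1.le))
    have hcont : ContinuousWithinAt (fun s => ∫ t in s..ρ, 1 / H t) (Set.Ioo ρm ρ) ρm := by
      have := intervalIntegral.continuousOn_primitive_interval_left
        ((intervalIntegrable_iff' (by simp)).1 hHi)
      refine (this ρm Set.left_mem_uIcc).mono ?_
      rw [Set.uIcc_of_le hρ]
      exact Set.Ioo_subset_Icc_self
    have : (nhdsWithin ρm (Set.Ioo ρm ρ)).NeBot := left_nhdsWithin_Ioo_neBot hρlt
    have hlim := le_of_tendsto
      (((Real.continuous_exp.tendsto _).comp (hcont.const_mul γ)).mul_const _)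
      (eventually_mem_nhdsWithin.mono hs)
    rw [neg_mul, Real.exp_neg, ← one_div, le_div_iff₀' (Real.exp_pos _)]
    exact hlim
  obtain ⟨v, hv, hvm, hvt⟩ := exists_seq_strictMono_tendsto' hρM
  have hcoe (k : ℕ) : ((v k).toReal : EReal) = v k :=
    EReal.coe_toReal ((hvm k).2.trans_le le_top).ne ((EReal.bot_lt_coe ρ).trans (hvm k).1).ne'
  have hunion : {x ∈ 𝒰 | ρ ≤ U x} = ⋃ k, {x ∈ 𝒰 | ρ ≤ U x ∧ U x ≤ (v k).toReal} := by
    ext x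
    simp only [Set.mem_ofPred_eq, Set.mem_iUnion]
    refine ⟨fun hx => ?_, fun ⟨k, hk⟩ => ⟨hk.1, hk.2.1⟩⟩
    obtain ⟨k, hk⟩ := (hvt.eventually (lt_mem_nhds (hU_lt x hx.1))).exists
    rw [← hcoe] at hk
    exact ⟨k, hx.1, hx.2, (EReal.coe_lt_coe_iff.1 hk).le⟩
  have hmeas (k : ℕ) : MeasurableSet {x ∈ 𝒰 | ρ ≤ U x ∧ U x ≤ (v k).toReal} := by
    have hopen := hU_C2.continuousOn.isOpen_inter_preimage hUopen
      (isClosed_Icc (a := ρ) (b := (v k).toReal)).isOpen_compl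
    convert! hUopen.measurableSet.diff hopen.measurableSet using 1
    ext x
    simp only [Set.mem_ofPred_eq, Set.mem_sdiff, Set.mem_inter_iff, Set.mem_preimage,
      Set.mem_compl_iff, Set.mem_Icc]
    tauto
  have hmono : Monotone fun k => {x ∈ 𝒰 | ρ ≤ U x ∧ U x ≤ (v k).toReal} := by
    intro k l hkl x hx
    refine ⟨hx.1, hx.2.1, hx.2.2.trans ?_⟩
    rw [← EReal.coe_le_coe_iff, hcoe, hcoe]
    exact hv.monotone hkl
  rw [hunion]
  refine le_of_tendsto (tendsto_setIntegral_of_monotone hmeas hmono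
    (hui.mono_set (Set.iUnion_subset fun k => Set.sep_subset _ _))) (.of_forall fun k => ?_)
  refine hlevel ?_ ?_
  · rw [← EReal.coe_le_coe_iff, hcoe]
    exact (hvm k).1.le
  · rw [hcoe]
    exact (hvm k).2
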